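/- There exist a bounded smooth vector field 𝐮 : [0,1] × ℝ → ℝ² and a smooth function p : [0,1] × ℝ → ℝ such that (𝐮·∇)𝐮 = −∇p and div 𝐮 = 0 in (0,1) × ℝ, the no-penetration boundary condition holds, i.e. the first component 𝐮¹(0, x₂) = 𝐮¹(1, x₂) = 0 for all x₂ ∈ ℝ, 𝐮(x) ≠ 0 for every x ∈ [0,1] × ℝ, and 𝐮 is not a shear flow: there do not exist a unit vector e = (e₁, e₂) ∈ ℝ² and a function U : ℝ → ℝ such that 𝐮(x) = U(x·e⊥) e for all x ∈ [0,1] × ℝ, where e⊥ = (−e₂, e₁). -/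

import Mathlib

open MeasureTheory

/-- Partial derivative of `u : ℝ² → ℝ` in the first coordinate. -/
noncomputable def pd1 (u : ℝ × ℝ → ℝ) (p : ℝ × ℝ) : ℝ := fderiv ℝ u p (1, 0)

/-- Partial derivative of `u : ℝ² → ℝ` in the second coordinate. -/
noncomputable def pd2 (u : ℝ × ℝ → ℝ) (p : ℝ × ℝ) : ℝ := fderiv ℝ u p (0, 1)

/-- Laplacian of `u : ℝ² → ℝ`. -/
noncomputable def lap2 (u : ℝ × ℝ → ℝ) (p : ℝ × ℝ) : ℝ :=
  fderiv ℝ (pd1 u) p (1, 0) + fderiv ℝ (pd2 u) p (0, 1)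

/-- Gradient of `u : ℝ² → ℝ`. -/
noncomputable def grad2 (u : ℝ × ℝ → ℝ) (p : ℝ × ℝ) : ℝ × ℝ := (pd1 u p, pd2 u p)

section EulerStrip

open Real

theorem hasDerivAt_slice_fst {u : ℝ × ℝ → ℝ} {x y : ℝ} (hu : DifferentiableAt ℝ u (x, y)) :
    HasDerivAt (fun t => u (t, y)) (pd1 u (x, y)) x :=
  hu.hasFDerivAt.comp_hasDerivAt x ((hasDerivAt_id x).prodMk (hasDerivAt_const x y))

theorem hasDerivAt_slice_snd {u : ℝ × ℝ → ℝ} {x y : ℝ} (hu : DifferentiableAt ℝ u (x, y)) :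
    HasDerivAt (fun t => u (x, t)) (pd2 u (x, y)) y :=
  hu.hasFDerivAt.comp_hasDerivAt y ((hasDerivAt_const y x).prodMk (hasDerivAt_id y))

/-- If the first partial derivative of a smooth `f` is bounded below by a positive constant, then
`f (a, y) = v` can be solved globally and smoothly for `a`. -/
theorem exists_contDiff_implicit {f : ℝ × ℝ → ℝ} {m : ℝ} (hm : 0 < m)
    (hf : ContDiff ℝ (⊤ : ℕ∞) f) (hpos : ∀ q, m ≤ fderiv ℝ f q (1, 0)) :
    ∃ A : ℝ × ℝ → ℝ, ContDiff ℝ (⊤ : ℕ∞) A ∧ ∀ v y, f (A (v, y), y) = v := by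
  have hd : ∀ q, DifferentiableAt ℝ f q := fun q => hf.differentiable (by simp) q
  have hline : ∀ a y, HasDerivAt (fun t => f (t, y)) (fderiv ℝ f (a, y) (1, 0)) a := fun a y =>
    hasDerivAt_slice_fst (hd (a, y))
  have hmono : ∀ y, StrictMono fun t => f (t, y) := fun y =>
    strictMono_of_deriv_pos fun a => by
      rw [(hline a y).deriv]; exact hm.trans_le (hpos _)
  have hgrow : ∀ y a b, a ≤ b → m * (b - a) ≤ f (b, y) - f (a, y) := fun y a b hab =>
    mul_sub_le_image_sub_of_le_deriv (fun t => (hline t y).differentiableAt)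
      (fun t => by rw [(hline t y).deriv]; exact hpos _) hab
  let Φ : ℝ × ℝ → ℝ × ℝ := fun q => (f q, q.2)
  have hΦ : ContDiff ℝ (⊤ : ℕ∞) Φ := hf.prodMk contDiff_snd
  have hinj : Function.Injective Φ := by
    rintro ⟨a, y⟩ ⟨b, z⟩ h
    obtain ⟨h1, rfl⟩ : f (a, y) = f (b, z) ∧ y = z := by simpa [Φ] using h
    exact Prod.ext ((hmono y).injective h1) rfl
  have hsurj : Function.Surjective Φ := by
    rintro ⟨v, y⟩
    have hcont : Continuous fun t => f (t, y) := by fun_prop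
    have hr : v ∈ Set.range fun t => f (t, y) := by
      have hT : 0 ≤ |v - f (0, y)| / m := by positivity
      have e : m * (|v - f (0, y)| / m) = |v - f (0, y)| := by field_simp
      have h1 := hgrow y _ _ hT
      have h2 := hgrow y _ _ (neg_nonpos.2 hT)
      refine mem_range_of_exists_le_of_exists_ge hcont ⟨-(|v - f (0, y)| / m), ?_⟩
        ⟨|v - f (0, y)| / m, ?_⟩
      · have := neg_abs_le (v - f (0, y)); linarith
      · have := le_abs_self (v - f (0, y)); linarith
    obtain ⟨a, ha⟩ := hr
    exact ⟨(a, y), Prod.ext ha rfl⟩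
  have hxy : ∀ q x y, fderiv ℝ f q (x, y)
      = x * fderiv ℝ f q (1, 0) + y * fderiv ℝ f q (0, 1) := fun q x y => by
    rw [← smul_eq_mul, ← smul_eq_mul, ← map_smul, ← map_smul, ← map_add]; simp
  let e' : ∀ q, (ℝ × ℝ) ≃L[ℝ] ℝ × ℝ := fun q =>
    ContinuousLinearEquiv.equivOfInverse
      ((fderiv ℝ f q).prod (ContinuousLinearMap.snd ℝ ℝ ℝ))
      (((fderiv ℝ f q (1, 0))⁻¹ • (ContinuousLinearMap.fst ℝ ℝ ℝ
        - (fderiv ℝ f q (0, 1)) • ContinuousLinearMap.snd ℝ ℝ ℝ)).prod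
        (ContinuousLinearMap.snd ℝ ℝ ℝ))
      (by
        rintro ⟨x, y⟩
        have h0 : fderiv ℝ f q (1, 0) ≠ 0 := (hm.trans_le (hpos q)).ne'
        refine Prod.ext ?_ rfl
        simp only [ContinuousLinearMap.prod_apply, smul_apply,
          sub_apply, ContinuousLinearMap.coe_fst',
          ContinuousLinearMap.coe_snd', smul_eq_mul, hxy q x y]
        field_simp
        ring)
      (by
        rintro ⟨x, y⟩
        have h0 : fderiv ℝ f q (1, 0) ≠ 0 := (hm.trans_le (hpos q)).ne'
        refine Prod.ext ?_ rfl
        simp only [ContinuousLinearMap.prod_apply, smul_apply,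
          sub_apply, ContinuousLinearMap.coe_fst',
          ContinuousLinearMap.coe_snd', smul_eq_mul]
        rw [hxy]
        field_simp
        ring)
  have hstrict : ∀ q, HasStrictFDerivAt Φ (e' q : (ℝ × ℝ) →L[ℝ] ℝ × ℝ) q := fun q =>
    (hf.contDiffAt.hasStrictFDerivAt (by simp)).prodMk hasStrictFDerivAt_snd
  let H : (ℝ × ℝ) ≃ₜ ℝ × ℝ := (Equiv.ofBijective Φ ⟨hinj, hsurj⟩).toHomeomorphOfContinuousOpen
    hΦ.continuous (isOpenMap_of_hasStrictFDerivAt_equiv hstrict)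
  have hsymm : ContDiff ℝ (⊤ : ℕ∞) H.symm :=
    H.contDiff_symm (fun q => (hstrict q).hasFDerivAt) hΦ
  refine ⟨fun q => (H.symm q).1, hsymm.fst, fun v y => ?_⟩
  have h : Φ (H.symm (v, y)) = (v, y) := H.apply_symm_apply (v, y)
  have h1 : f (H.symm (v, y)) = v := congrArg Prod.fst h
  have h2 : (H.symm (v, y)).2 = y := congrArg Prod.snd h
  have h3 : ((H.symm (v, y)).1, y) = H.symm (v, y) := Prod.ext rfl h2.symm
  rw [h3, h1]

/-- The logarithmic derivative of `velocityWeight` along a curve. -/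
noncomputable def weightLogDeriv (T h c a' T' : ℝ) : ℝ :=
  -T' / (1 + T) - ((4 * h * c - c ^ 2 - h ^ 2) * a' / (c ^ 2 + h ^ 2 - h * c)
    + (2 * T' * c + 2 * (1 + T) * h * a' - c * a') / (2 * (1 + T) * c - h) + h * a' / c) / 2

/-- The common factor of both velocity components, in terms of `T = exp (-(π y + a))` and the
profile value `a`. -/
noncomputable def velocityWeight (T a : ℝ) : ℝ :=
  1 / ((1 + T) * √((cosh a ^ 2 + sinh a ^ 2 - sinh a * cosh a)
    * (2 * (1 + T) * cosh a - sinh a) * cosh a))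

theorem abs_sinh_lt_cosh (a : ℝ) : |sinh a| < cosh a := by
  rw [← sq_lt_sq₀ (abs_nonneg _) (cosh_pos a).le, sq_abs, cosh_sq]; linarith

theorem cosh_sq_add_sinh_sq_sub_pos (a : ℝ) :
    1 / 2 ≤ cosh a ^ 2 + sinh a ^ 2 - sinh a * cosh a := by
  nlinarith [cosh_sq a, sq_nonneg (cosh a - sinh a), sq_nonneg (sinh a)]

theorem cosh_lt_two_mul_sub {T : ℝ} (hT : 0 < T) (a : ℝ) :
    cosh a < 2 * (1 + T) * cosh a - sinh a := by
  nlinarith [abs_sinh_lt_cosh a, le_abs_self (sinh a), cosh_pos a, mul_pos hT (cosh_pos a)]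

theorem velocityWeight_sq {T : ℝ} (hT : 0 < T) (a : ℝ) :
    velocityWeight T a ^ 2 = 1 / ((1 + T) ^ 2 * ((cosh a ^ 2 + sinh a ^ 2 - sinh a * cosh a)
      * (2 * (1 + T) * cosh a - sinh a) * cosh a)) := by
  have hc := cosh_pos a
  have hg := cosh_sq_add_sinh_sq_sub_pos a
  have hR := cosh_lt_two_mul_sub hT a
  have hg0 : 0 < cosh a ^ 2 + sinh a ^ 2 - sinh a * cosh a := by linarith
  have hR0 := hc.trans hR
  rw [velocityWeight, div_pow, mul_pow, sq_sqrt (by positivity), one_pow]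

theorem velocityWeight_pos {T : ℝ} (hT : 0 < T) (a : ℝ) : 0 < velocityWeight T a := by
  have hc := cosh_pos a
  have hg := cosh_sq_add_sinh_sq_sub_pos a
  have hR := cosh_lt_two_mul_sub hT a
  have hg0 : 0 < cosh a ^ 2 + sinh a ^ 2 - sinh a * cosh a := by linarith
  have hR0 := hc.trans hR
  unfold velocityWeight
  positivity

theorem hasDerivAt_velocityWeight {T a : ℝ → ℝ} {T' a' t : ℝ} (hT : HasDerivAt T T' t)
    (ha : HasDerivAt a a' t) (hpos : 0 < T t) :
    HasDerivAt (fun t => velocityWeight (T t) (a t))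
      (weightLogDeriv (T t) (sinh (a t)) (cosh (a t)) a' T' * velocityWeight (T t) (a t)) t := by
  have hc := cosh_pos (a t)
  have hg := cosh_sq_add_sinh_sq_sub_pos (a t)
  have hR := cosh_lt_two_mul_sub hpos (a t)
  have hg0 : 0 < cosh (a t) ^ 2 + sinh (a t) ^ 2 - sinh (a t) * cosh (a t) := by linarith
  have hR0 := hc.trans hR
  have hN := mul_pos (mul_pos hg0 hR0) hc
  have dc := ha.cosh
  have ds := ha.sinh
  have dg := ((dc.pow 2).add (ds.pow 2)).sub (ds.mul dc)
  have dR := (((hT.const_add 1).const_mul 2).mul dc).sub ds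
  have dN := ((dg.mul dR).mul dc).sqrt hN.ne'
  have dW := (hasDerivAt_const t (1 : ℝ)).div ((hT.const_add 1).mul dN)
    (mul_ne_zero (by linarith) (sqrt_ne_zero'.2 hN))
  refine dW.congr_deriv ?_
  have hr := sq_sqrt hN.le
  have hr0 := sqrt_pos.2 hN
  simp only [velocityWeight, weightLogDeriv, Pi.add_apply, Pi.sub_apply, Pi.mul_apply, Pi.pow_apply]
  generalize √((cosh (a t) ^ 2 + sinh (a t) ^ 2 - sinh (a t) * cosh (a t))
    * (2 * (1 + T t) * cosh (a t) - sinh (a t)) * cosh (a t)) = r at *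
  generalize cosh (a t) = c at *
  generalize sinh (a t) = h at *
  generalize T t = T at *
  have h1 : 1 + T ≠ 0 := by linarith
  obtain ⟨g, hgd⟩ : ∃ g, g = c ^ 2 + h ^ 2 - h * c := ⟨_, rfl⟩
  obtain ⟨R, hRd⟩ : ∃ R, R = 2 * (1 + T) * c - h := ⟨_, rfl⟩
  rw [← hgd] at hg0
  rw [← hRd] at hR0
  simp only [← hgd, ← hRd] at hr ⊢
  have hgn := hg0.ne'
  have hRn := hR0.ne'
  have hcn := hc.ne'
  have hrn := hr0.ne'
  have key : ∀ N' : ℝ, N' / (2 * r) = r * (N' / (2 * (g * R * c))) := fun N' => by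
    rw [← hr]; field_simp
  rw [key]
  field_simp
  ring

section Algebra

variable {T s k h c R g a₁ a₂ E : ℝ}

theorem weight_divergence_identity
    (hR : R = 2 * (1 + T) * c - h) (hg : g = c ^ 2 + h ^ 2 - h * c) (hE : E ≠ 0)
    (hc : c = (E + E⁻¹) / 2) (hh : h = (E - E⁻¹) / 2) (hs : s ^ 2 = h * R)
    (hT0 : 1 + T ≠ 0) (hg0 : g ≠ 0) (hR0 : R ≠ 0) (hc0 : c ≠ 0)
    (h₁ : a₁ = s * k / (g * (1 + T))) (h₂ : a₂ = T * h * c / (g * (1 + T))) :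
    (-T * a₁ * s * c + T * k * c + T * s * h * a₁
        + T * s * c * weightLogDeriv T h c a₁ (-T * a₁))
      + (-k * (2 * (-T * (1 + a₂)) * c + 2 * (1 + T) * h * a₂ - c * a₂)
        - k * R * weightLogDeriv T h c a₂ (-T * (1 + a₂))) = 0 := by
  simp only [weightLogDeriv, ← hR, ← hg]
  subst h₁ h₂
  field_simp
  ring_nf
  simp only [hs]
  subst hR hg hc hh
  field_simp
  ring

theorem weight_momentum_identity_fst
    (hR : R = 2 * (1 + T) * c - h) (hg : g = c ^ 2 + h ^ 2 - h * c) (hE : E ≠ 0)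
    (hc : c = (E + E⁻¹) / 2) (hh : h = (E - E⁻¹) / 2) (hs : s ^ 2 = h * R)
    (hT0 : 1 + T ≠ 0) (hg0 : g ≠ 0) (hR0 : R ≠ 0) (hc0 : c ≠ 0)
    (h₁ : a₁ = s * k / (g * (1 + T))) (h₂ : a₂ = T * h * c / (g * (1 + T))) :
    (T * s * c * (-T * a₁ * s * c + T * k * c + T * s * h * a₁
        + T * s * c * weightLogDeriv T h c a₁ (-T * a₁))
      - k * R * (-T * (1 + a₂) * s * c + T * s * h * a₂
        + T * s * c * weightLogDeriv T h c a₂ (-T * (1 + a₂))))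
      / ((1 + T) ^ 2 * (g * R * c)) = -(-T * a₁ / (1 + T) ^ 2) := by
  have hs3 : s ^ 3 = s * (h * R) := by rw [← hs]; ring
  simp only [weightLogDeriv, ← hR, ← hg]
  subst h₁ h₂
  field_simp
  ring_nf
  simp only [hs3]
  subst hR hg hc hh
  field_simp
  ring

theorem weight_momentum_identity_snd
    (hR : R = 2 * (1 + T) * c - h) (hg : g = c ^ 2 + h ^ 2 - h * c) (hE : E ≠ 0)
    (hc : c = (E + E⁻¹) / 2) (hh : h = (E - E⁻¹) / 2) (hs : s ^ 2 = h * R)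
    (hk : k ^ 2 = 1 - h * R) (hT0 : 1 + T ≠ 0) (hg0 : g ≠ 0) (hR0 : R ≠ 0) (hc0 : c ≠ 0)
    (h₁ : a₁ = s * k / (g * (1 + T))) (h₂ : a₂ = T * h * c / (g * (1 + T))) :
    (T * s * c * (s * R - k * (2 * (-T * a₁) * c + 2 * (1 + T) * h * a₁ - c * a₁)
        - k * R * weightLogDeriv T h c a₁ (-T * a₁))
      - k * R * (-k * (2 * (-T * (1 + a₂)) * c + 2 * (1 + T) * h * a₂ - c * a₂)
        - k * R * weightLogDeriv T h c a₂ (-T * (1 + a₂))))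
      / ((1 + T) ^ 2 * (g * R * c)) = -(-T * (1 + a₂) / (1 + T) ^ 2) := by
  simp only [weightLogDeriv, ← hR, ← hg]
  subst h₁ h₂
  field_simp
  ring_nf
  simp only [hs, hk]
  subst hR hg hc hh
  field_simp
  ring

end Algebra

theorem hasDerivAt_constraint {a y : ℝ → ℝ} {a' y' t : ℝ} (ha : HasDerivAt a a' t)
    (hy : HasDerivAt y y' t) :
    HasDerivAt (fun t => sinh (a t) * (2 * (1 + exp (-(y t + a t))) * cosh (a t) - sinh (a t)))
      (2 * (cosh (a t) ^ 2 + sinh (a t) ^ 2 - sinh (a t) * cosh (a t))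
        * (1 + exp (-(y t + a t))) * a'
        - 2 * exp (-(y t + a t)) * sinh (a t) * cosh (a t) * y') t := by
  refine (ha.sinh.mul ((((((hy.add ha).neg.exp).const_add 1).const_mul 2).mul
        ha.cosh).sub ha.sinh)).congr_deriv ?_
  simp only [Pi.add_apply, Pi.sub_apply, Pi.mul_apply, Pi.neg_apply]
  ring

theorem exists_contDiff_profile : ∃ a : ℝ × ℝ → ℝ, ContDiff ℝ (⊤ : ℕ∞) a ∧ ∀ x y,
    sinh (a (x, y)) * (2 * (1 + exp (-(π * y + a (x, y)))) * cosh (a (x, y)) - sinh (a (x, y)))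
      = sin (π * x) ^ 2 := by
  let f : ℝ × ℝ → ℝ := fun q =>
    sinh q.1 * (2 * (1 + exp (-(q.2 + q.1))) * cosh q.1 - sinh q.1)
  have hf : ContDiff ℝ (⊤ : ℕ∞) f := by fun_prop
  have hpos : ∀ q, 1 ≤ fderiv ℝ f q (1, 0) := by
    rintro ⟨a, y⟩
    have h1 : HasDerivAt (fun t => f (t, y)) (fderiv ℝ f (a, y) (1, 0)) a :=
      hasDerivAt_slice_fst (hf.differentiable (by simp) (a, y))
    rw [h1.unique (hasDerivAt_constraint (hasDerivAt_id a) (hasDerivAt_const a y))]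
    have hg := cosh_sq_add_sinh_sq_sub_pos a
    have he := exp_pos (-(y + a))
    simp only
    nlinarith
  obtain ⟨A, hA, hAf⟩ := exists_contDiff_implicit one_pos hf hpos
  exact ⟨fun x => A (sin (π * x.1) ^ 2, π * x.2), by fun_prop, fun x y => hAf _ _⟩

theorem hasDerivAt_velocity_fst {T a s : ℝ → ℝ} {T' a' s' t : ℝ} (hT : HasDerivAt T T' t)
    (ha : HasDerivAt a a' t) (hs : HasDerivAt s s' t) (hpos : 0 < T t) :
    HasDerivAt (fun t => T t * s t * cosh (a t) * velocityWeight (T t) (a t))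
      ((T' * s t * cosh (a t) + T t * s' * cosh (a t) + T t * s t * sinh (a t) * a'
        + T t * s t * cosh (a t) * weightLogDeriv (T t) (sinh (a t)) (cosh (a t)) a' T')
        * velocityWeight (T t) (a t)) t := by
  refine (((hT.mul hs).mul ha.cosh).mul (hasDerivAt_velocityWeight hT ha hpos)).congr_deriv ?_
  simp only [Pi.mul_apply]
  ring

theorem hasDerivAt_velocity_snd {T a k : ℝ → ℝ} {T' a' k' t : ℝ} (hT : HasDerivAt T T' t)
    (ha : HasDerivAt a a' t) (hk : HasDerivAt k k' t) (hpos : 0 < T t) :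
    HasDerivAt (fun t => -(k t * (2 * (1 + T t) * cosh (a t) - sinh (a t))
        * velocityWeight (T t) (a t)))
      ((-k' * (2 * (1 + T t) * cosh (a t) - sinh (a t))
        - k t * (2 * T' * cosh (a t) + 2 * (1 + T t) * sinh (a t) * a' - cosh (a t) * a')
        - k t * (2 * (1 + T t) * cosh (a t) - sinh (a t))
          * weightLogDeriv (T t) (sinh (a t)) (cosh (a t)) a' T')
        * velocityWeight (T t) (a t)) t := by
  refine ((hk.mul ((((hT.const_add 1).const_mul 2).mul ha.cosh).sub ha.sinh)).mul
    (hasDerivAt_velocityWeight hT ha hpos)).neg.congr_deriv ?_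
  simp only [Pi.mul_apply, Pi.sub_apply]
  ring

theorem hasDerivAt_pressure {T : ℝ → ℝ} {T' t : ℝ} (hT : HasDerivAt T T' t) (hpos : 0 < T t) :
    HasDerivAt (fun t => -(1 + T t)⁻¹) (T' / (1 + T t) ^ 2) t := by
  refine ((hT.const_add 1).inv (by linarith)).neg.congr_deriv ?_
  ring

theorem hasDerivAt_profile_fst {a : ℝ × ℝ → ℝ} (ha : ContDiff ℝ (⊤ : ℕ∞) a)
    (hac : ∀ x y, sinh (a (x, y)) * (2 * (1 + exp (-(π * y + a (x, y)))) * cosh (a (x, y))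
      - sinh (a (x, y))) = sin (π * x) ^ 2) (x y : ℝ) :
    HasDerivAt (fun t => a (t, y)) (π * (sin (π * x) * cos (π * x)
      / ((cosh (a (x, y)) ^ 2 + sinh (a (x, y)) ^ 2 - sinh (a (x, y)) * cosh (a (x, y)))
        * (1 + exp (-(π * y + a (x, y))))))) x := by
  have hd : DifferentiableAt ℝ a (x, y) := ha.differentiable (by simp) (x, y)
  have h0 := hasDerivAt_slice_fst hd
  have h1 := hasDerivAt_constraint h0 (hasDerivAt_const x (π * y))
  have h2 := (((hasDerivAt_id x).const_mul π).sin).pow 2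
  have h3 := h1.unique (h2.congr_of_eventuallyEq (Filter.Eventually.of_forall fun t => hac t y))
  refine h0.congr_deriv ?_
  have hg := cosh_sq_add_sinh_sq_sub_pos (a (x, y))
  have he := exp_pos (-(π * y + a (x, y)))
  rw [← mul_div_assoc, eq_div_iff (by positivity)]
  simp only [id, Nat.cast_ofNat, Nat.add_one_sub_one, pow_one] at h3
  linarith

theorem hasDerivAt_profile_snd {a : ℝ × ℝ → ℝ} (ha : ContDiff ℝ (⊤ : ℕ∞) a)
    (hac : ∀ x y, sinh (a (x, y)) * (2 * (1 + exp (-(π * y + a (x, y)))) * cosh (a (x, y))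
      - sinh (a (x, y))) = sin (π * x) ^ 2) (x y : ℝ) :
    HasDerivAt (fun t => a (x, t)) (π * (exp (-(π * y + a (x, y))) * sinh (a (x, y))
        * cosh (a (x, y))
      / ((cosh (a (x, y)) ^ 2 + sinh (a (x, y)) ^ 2 - sinh (a (x, y)) * cosh (a (x, y)))
        * (1 + exp (-(π * y + a (x, y))))))) y := by
  have hd : DifferentiableAt ℝ a (x, y) := ha.differentiable (by simp) (x, y)
  have h0 := hasDerivAt_slice_snd hd
  have h1 := hasDerivAt_constraint h0 ((hasDerivAt_id y).const_mul π)
  have h3 := h1.unique ((hasDerivAt_const y (sin (π * x) ^ 2)).congr_of_eventuallyEq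
    (Filter.Eventually.of_forall fun t => hac x t))
  refine h0.congr_deriv ?_
  have hg := cosh_sq_add_sinh_sq_sub_pos (a (x, y))
  have he := exp_pos (-(π * y + a (x, y)))
  rw [← mul_div_assoc, eq_div_iff (by positivity)]
  simp only [id] at h3
  linarith

theorem abs_velocity_fst_le {T s : ℝ} (hT : 0 < T) (hs : s ^ 2 ≤ 1) (a : ℝ) :
    |T * s * cosh a * velocityWeight T a| ≤ 3 := by
  refine abs_le_of_sq_le_sq ?_ (by norm_num)
  have hc := cosh_pos a
  have hg := cosh_sq_add_sinh_sq_sub_pos a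
  have hR := cosh_lt_two_mul_sub hT a
  have hR0 := hc.trans hR
  rw [mul_pow, velocityWeight_sq hT]
  generalize cosh a ^ 2 + sinh a ^ 2 - sinh a * cosh a = g at *
  generalize 2 * (1 + T) * cosh a - sinh a = R at *
  generalize cosh a = c at *
  have hg0 : 0 < g := by linarith
  rw [mul_one_div, div_le_iff₀ (by positivity)]
  calc (T * s * c) ^ 2 = T ^ 2 * (s ^ 2 * (c * c)) := by ring
    _ ≤ (1 + T) ^ 2 * (1 * (2 * g * R * c)) := by
        gcongr
        · linarith
        · nlinarith
    _ ≤ _ := by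
        have : 0 < (1 + T) ^ 2 * (g * R * c) := by positivity
        linarith

theorem abs_velocity_snd_le {T k : ℝ} (hT : 0 < T) (hk : k ^ 2 ≤ 1) (a : ℝ) :
    |k * (2 * (1 + T) * cosh a - sinh a) * velocityWeight T a| ≤ 3 := by
  refine abs_le_of_sq_le_sq ?_ (by norm_num)
  have hc := cosh_pos a
  have hg := cosh_sq_add_sinh_sq_sub_pos a
  have hR := cosh_lt_two_mul_sub hT a
  have hR0 := hc.trans hR
  have hR3 : 2 * (1 + T) * cosh a - sinh a ≤ 3 * (1 + T) ^ 2 * cosh a := by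
    nlinarith [abs_sinh_lt_cosh a, neg_abs_le (sinh a), mul_pos hT hc,
      mul_pos (mul_pos hT hT) hc]
  rw [mul_pow, velocityWeight_sq hT]
  generalize cosh a ^ 2 + sinh a ^ 2 - sinh a * cosh a = g at *
  generalize 2 * (1 + T) * cosh a - sinh a = R at *
  generalize cosh a = c at *
  have hg0 : 0 < g := by linarith
  rw [mul_one_div, div_le_iff₀ (by positivity)]
  calc (k * R) ^ 2 = k ^ 2 * (R * R) := by ring
    _ ≤ 1 * (R * (3 * (1 + T) ^ 2 * c)) := by gcongr
    _ = 3 * ((1 + T) ^ 2 * R * c) * 1 := by ring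
    _ ≤ 3 * ((1 + T) ^ 2 * R * c) * (2 * g) := by gcongr; linarith
    _ ≤ _ := by
        have : 0 < (1 + T) ^ 2 * (g * R * c) := by positivity
        linarith

theorem contDiff_velocityWeight {T a : ℝ × ℝ → ℝ} (hT : ContDiff ℝ (⊤ : ℕ∞) T)
    (ha : ContDiff ℝ (⊤ : ℕ∞) a) (hpos : ∀ q, 0 < T q) :
    ContDiff ℝ (⊤ : ℕ∞) fun q => velocityWeight (T q) (a q) := by
  have hN : ∀ q, 0 < (cosh (a q) ^ 2 + sinh (a q) ^ 2 - sinh (a q) * cosh (a q))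
      * (2 * (1 + T q) * cosh (a q) - sinh (a q)) * cosh (a q) := fun q =>
    mul_pos (mul_pos (by linarith [cosh_sq_add_sinh_sq_sub_pos (a q)])
      ((cosh_pos _).trans (cosh_lt_two_mul_sub (hpos q) _))) (cosh_pos _)
  unfold velocityWeight
  refine contDiff_const.div (ContDiff.mul (by fun_prop) (ContDiff.sqrt (by fun_prop)
    fun q => (hN q).ne')) fun q => mul_ne_zero (by linarith [hpos q]) (sqrt_ne_zero'.2 (hN q))

/-- First velocity component of the flow with profile `a`. -/
noncomputable def flowFst (a : ℝ × ℝ → ℝ) (q : ℝ × ℝ) : ℝ :=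
  exp (-(π * q.2 + a q)) * sin (π * q.1) * cosh (a q)
    * velocityWeight (exp (-(π * q.2 + a q))) (a q)

/-- Second velocity component of the flow with profile `a`. -/
noncomputable def flowSnd (a : ℝ × ℝ → ℝ) (q : ℝ × ℝ) : ℝ :=
  -(cos (π * q.1) * (2 * (1 + exp (-(π * q.2 + a q))) * cosh (a q) - sinh (a q))
    * velocityWeight (exp (-(π * q.2 + a q))) (a q))

/-- Pressure of the flow with profile `a`. -/
noncomputable def flowPressure (a : ℝ × ℝ → ℝ) (q : ℝ × ℝ) : ℝ :=
  -(1 + exp (-(π * q.2 + a q)))⁻¹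

theorem contDiff_flowFst {a : ℝ × ℝ → ℝ} (ha : ContDiff ℝ (⊤ : ℕ∞) a) :
    ContDiff ℝ (⊤ : ℕ∞) (flowFst a) :=
  ContDiff.mul (by fun_prop) (contDiff_velocityWeight (by fun_prop) ha fun _ => exp_pos _)

theorem contDiff_flowSnd {a : ℝ × ℝ → ℝ} (ha : ContDiff ℝ (⊤ : ℕ∞) a) :
    ContDiff ℝ (⊤ : ℕ∞) (flowSnd a) :=
  (ContDiff.mul (by fun_prop) (contDiff_velocityWeight (by fun_prop) ha fun _ => exp_pos _)).neg

theorem contDiff_flowPressure {a : ℝ × ℝ → ℝ} (ha : ContDiff ℝ (⊤ : ℕ∞) a) :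
    ContDiff ℝ (⊤ : ℕ∞) (flowPressure a) :=
  (ContDiff.inv (by fun_prop) fun _ => (add_pos one_pos (exp_pos _)).ne').neg

/-- The flow of a profile satisfying the implicit constraint solves the stationary Euler
equations. -/
theorem flow_euler {a : ℝ × ℝ → ℝ} (ha : ContDiff ℝ (⊤ : ℕ∞) a)
    (hac : ∀ x y, sinh (a (x, y)) * (2 * (1 + exp (-(π * y + a (x, y)))) * cosh (a (x, y))
      - sinh (a (x, y))) = sin (π * x) ^ 2) (q : ℝ × ℝ) :
    pd1 (flowFst a) q + pd2 (flowSnd a) q = 0 ∧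
    flowFst a q * pd1 (flowFst a) q + flowSnd a q * pd2 (flowFst a) q
      = -(pd1 (flowPressure a) q) ∧
    flowFst a q * pd1 (flowSnd a) q + flowSnd a q * pd2 (flowSnd a) q
      = -(pd2 (flowPressure a) q) := by
  obtain ⟨x, y⟩ := q
  have da₁ := hasDerivAt_profile_fst ha hac x y
  have da₂ := hasDerivAt_profile_snd ha hac x y
  have ds := ((hasDerivAt_id x).const_mul π).sin
  have dk := ((hasDerivAt_id x).const_mul π).cos
  have dT₁ := (da₁.const_add (π * y)).neg.exp
  have dT₂ := (((hasDerivAt_id y).const_mul π).add da₂).neg.exp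
  have hT := exp_pos (-(π * y + a (x, y)))
  have d1 := (contDiff_flowFst ha).differentiable (by simp) (x, y)
  have d2 := (contDiff_flowSnd ha).differentiable (by simp) (x, y)
  have d3 := (contDiff_flowPressure ha).differentiable (by simp) (x, y)
  have e11 := (hasDerivAt_slice_fst d1).unique (hasDerivAt_velocity_fst dT₁ da₁ ds hT)
  have e12 := (hasDerivAt_slice_snd d1).unique
    (hasDerivAt_velocity_fst dT₂ da₂ (hasDerivAt_const y (sin (π * x))) hT)
  have e21 := (hasDerivAt_slice_fst d2).unique (hasDerivAt_velocity_snd dT₁ da₁ dk hT)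
  have e22 := (hasDerivAt_slice_snd d2).unique
    (hasDerivAt_velocity_snd dT₂ da₂ (hasDerivAt_const y (cos (π * x))) hT)
  have e31 := (hasDerivAt_slice_fst d3).unique (hasDerivAt_pressure dT₁ hT)
  have e32 := (hasDerivAt_slice_snd d3).unique (hasDerivAt_pressure dT₂ hT)
  have hW := velocityWeight_sq hT (a (x, y))
  have hc := cosh_pos (a (x, y))
  have hg := cosh_sq_add_sinh_sq_sub_pos (a (x, y))
  have hR := cosh_lt_two_mul_sub hT (a (x, y))
  have hR0 := hc.trans hR
  have hE := exp_pos (a (x, y))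
  have hcE : cosh (a (x, y)) = (exp (a (x, y)) + (exp (a (x, y)))⁻¹) / 2 := by
    rw [cosh_eq, exp_neg]
  have hhE : sinh (a (x, y)) = (exp (a (x, y)) - (exp (a (x, y)))⁻¹) / 2 := by
    rw [sinh_eq, exp_neg]
  have hs := (hac x y).symm
  have hk := cos_sq' (π * x)
  rw [hs] at hk
  rw [e11, e12, e21, e22, e31, e32, flowFst, flowSnd]
  simp only [id, Pi.neg_apply, Pi.add_apply, mul_one] at *
  generalize velocityWeight (exp (-(π * y + a (x, y)))) (a (x, y)) = W at *
  generalize exp (-(π * y + a (x, y))) = T at *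
  generalize cosh (a (x, y)) = c at *
  generalize sinh (a (x, y)) = h at *
  generalize exp (a (x, y)) = E at *
  generalize sin (π * x) = s at *
  generalize cos (π * x) = k at *
  have hT0 : 1 + T ≠ 0 := by linarith
  have hg0 : c ^ 2 + h ^ 2 - h * c ≠ 0 := by linarith
  have t1 := weight_divergence_identity (k := k) rfl rfl hE.ne' hcE hhE hs hT0 hg0 hR0.ne' hc.ne'
    rfl rfl
  have t2 := (div_eq_mul_one_div _ _).symm.trans (weight_momentum_identity_fst (k := k)
    rfl rfl hE.ne' hcE hhE hs hT0 hg0 hR0.ne' hc.ne' rfl rfl)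
  have t3 := (div_eq_mul_one_div _ _).symm.trans (weight_momentum_identity_snd
    rfl rfl hE.ne' hcE hhE hs hk hT0 hg0 hR0.ne' hc.ne' rfl rfl)
  rw [← hW] at t2 t3
  clear e11 e12 e21 e22 e31 e32 dT₁ dT₂ da₁ da₂ ds dk
  generalize s * k / ((c ^ 2 + h ^ 2 - h * c) * (1 + T)) = a₁ at *
  generalize T * h * c / ((c ^ 2 + h ^ 2 - h * c) * (1 + T)) = a₂ at *
  have hom : ∀ a' T', weightLogDeriv T h c (π * a') (π * T') = π * weightLogDeriv T h c a' T' :=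
    fun a' T' => by unfold weightLogDeriv; ring
  have e1 : T * -(π * a₁) = π * (-T * a₁) := by ring
  have e2 : T * -(π + π * a₂) = π * (-T * (1 + a₂)) := by ring
  rw [e1, e2, hom, hom]
  refine ⟨?_, ?_, ?_⟩
  · linear_combination π * W * t1
  · linear_combination π * t2
  · linear_combination π * t3

theorem abs_flowFst_le (a : ℝ × ℝ → ℝ) (q : ℝ × ℝ) : |flowFst a q| ≤ 3 :=
  abs_velocity_fst_le (exp_pos _) (sin_sq_le_one _) _

theorem abs_flowSnd_le (a : ℝ × ℝ → ℝ) (q : ℝ × ℝ) : |flowSnd a q| ≤ 3 := by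
  rw [flowSnd, abs_neg]
  exact abs_velocity_snd_le (exp_pos _) (cos_sq_le_one _) _

theorem flowFst_eq_zero_iff {a : ℝ × ℝ → ℝ} {q : ℝ × ℝ} :
    flowFst a q = 0 ↔ sin (π * q.1) = 0 := by
  have hT := exp_pos (-(π * q.2 + a q))
  simp only [flowFst, mul_eq_zero, (velocityWeight_pos hT (a q)).ne', (cosh_pos (a q)).ne', hT.ne',
    false_or, or_false]

theorem flowSnd_eq_zero_iff {a : ℝ × ℝ → ℝ} {q : ℝ × ℝ} :
    flowSnd a q = 0 ↔ cos (π * q.1) = 0 := by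
  have hT := exp_pos (-(π * q.2 + a q))
  have hR := (cosh_pos (a q)).trans (cosh_lt_two_mul_sub hT (a q))
  simp only [flowSnd, neg_eq_zero, mul_eq_zero (b := velocityWeight _ _),
    mul_eq_zero (a := cos _), (velocityWeight_pos hT (a q)).ne', hR.ne', or_false]

end EulerStrip

/-- there are a bounded smooth velocity field `𝐮` and a smooth pressure `p` on
the strip `[0,1] × ℝ` solving the stationary Euler equations in `(0,1) × ℝ`, satisfying the
no-penetration boundary condition, with `𝐮` nowhere vanishing on the closed strip and not a
shear flow. -/
theorem euler_strip_no_stagnation_not_shear :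
    ∃ U : ℝ × ℝ → ℝ × ℝ, ∃ p : ℝ × ℝ → ℝ,
      ContDiffOn ℝ (⊤ : ℕ∞) U (Set.Icc (0:ℝ) 1 ×ˢ (Set.univ : Set ℝ)) ∧
      ContDiffOn ℝ (⊤ : ℕ∞) p (Set.Icc (0:ℝ) 1 ×ˢ (Set.univ : Set ℝ)) ∧
      (∃ M : ℝ, ∀ q ∈ Set.Icc (0:ℝ) 1 ×ˢ (Set.univ : Set ℝ), ‖U q‖ ≤ M) ∧
      (∀ q ∈ Set.Ioo (0:ℝ) 1 ×ˢ (Set.univ : Set ℝ),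
        pd1 (fun z => (U z).1) q + pd2 (fun z => (U z).2) q = 0) ∧
      (∀ q ∈ Set.Ioo (0:ℝ) 1 ×ˢ (Set.univ : Set ℝ),
        (U q).1 * pd1 (fun z => (U z).1) q + (U q).2 * pd2 (fun z => (U z).1) q
          = -(pd1 p q) ∧
        (U q).1 * pd1 (fun z => (U z).2) q + (U q).2 * pd2 (fun z => (U z).2) q
          = -(pd2 p q)) ∧
      (∀ x₂ : ℝ, (U (0, x₂)).1 = 0 ∧ (U (1, x₂)).1 = 0) ∧
      (∀ q ∈ Set.Icc (0:ℝ) 1 ×ˢ (Set.univ : Set ℝ), U q ≠ 0) ∧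
      ¬ ∃ e : ℝ × ℝ, ‖e‖ = 1 ∧ ∃ V : ℝ → ℝ,
        ∀ q ∈ Set.Icc (0:ℝ) 1 ×ˢ (Set.univ : Set ℝ),
          U q = (V (q.1 * (-e.2) + q.2 * e.1) * e.1,
                 V (q.1 * (-e.2) + q.2 * e.1) * e.2) := by
  obtain ⟨a, ha, hac⟩ := exists_contDiff_profile
  have h1 := contDiff_flowFst ha
  have h2 := contDiff_flowSnd ha
  refine ⟨fun q => (flowFst a q, flowSnd a q), flowPressure a, (h1.prodMk h2).contDiffOn,
    (contDiff_flowPressure ha).contDiffOn, ⟨3, fun q _ => ?_⟩, fun q _ => (flow_euler ha hac q).1,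
    fun q _ => (flow_euler ha hac q).2, fun y => ⟨?_, ?_⟩, fun q _ hq => ?_, ?_⟩
  · exact max_le (abs_flowFst_le a q) (abs_flowSnd_le a q)
  · simp [flowFst]
  · simp [flowFst]
  · obtain ⟨hu, hv⟩ := Prod.mk.inj hq
    rw [flowFst_eq_zero_iff] at hu
    rw [flowSnd_eq_zero_iff] at hv
    have := Real.sin_sq_add_cos_sq (Real.pi * q.1)
    rw [hu, hv] at this
    norm_num at this
  · rintro ⟨e, -, V, h⟩
    obtain ⟨h3, h4⟩ := Prod.mk.inj (h (0, 0) (by simp))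
    obtain ⟨h5, -⟩ := Prod.mk.inj (h (1 / 2, 0) (by norm_num))
    have h6 : flowFst a (0, 0) = 0 := by rw [flowFst_eq_zero_iff]; simp
    have h7 : flowSnd a (0, 0) ≠ 0 := by rw [Ne, flowSnd_eq_zero_iff]; simp
    have h8 : flowFst a (1 / 2, 0) ≠ 0 := by
      rw [Ne, flowFst_eq_zero_iff, mul_one_div, Real.sin_pi_div_two]; exact one_ne_zero
    rw [h6] at h3
    rcases mul_eq_zero.1 h3.symm with hV | he
    · exact h7 (by rw [h4, hV, zero_mul])
    · exact h8 (by rw [h5, he, mul_zero])
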